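/- arXiv:1609.07732 — 3 statements merged into one kernel-verified Lean document; each statement's English description precedes it below -/
import Mathlib

section
/- Let Y be a strongly indecomposable object of C. Assume that there is an isomorphism of functors D Ext(Y,−) ≅ Hom̄(−,Y') on C for some object Y', and that Y' has a non-injective strongly indecomposable direct summand. Then there exists an almost split conflation X → E → Y in C ending at Y. -/
/-!
Common setup: a Hom-finite Krull-Schmidt `k`-linear abelian category `C`, regarded as an exact
category whose conflations are all short exact sequences.  The Yoneda Ext¹-bifunctor of this
exact structure, together with the assignment of its extension class to each short exact
sequence and the standard pullback/pushout functorialities, is axiomatized by the structure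
`YonedaExt` below.  (Over a field, Hom-finiteness together with the existence of an abelian
structure makes `C` Krull-Schmidt automatically.)
-/

open CategoryTheory CategoryTheory.Limits

universe v u

namespace GenAR

/-- An axiomatization of the Yoneda `Ext¹`-bifunctor of a `k`-linear abelian category `C`
(with the exact structure given by all short exact sequences):  `ext X Y` is the `k`-module
of equivalence classes of conflations `Y → E → X`; `pull f Y` is `Ext(f,Y)` (pullback, i.e.
`μ ↦ μ.f`); `push X g` is `Ext(X,g)` (pushout, i.e. `μ ↦ g.μ`); `cls` assigns to a short
exact sequence its class, which vanishes iff the sequence splits; every class is realized by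
a conflation, and pullback/pushout classes are realized by actual pullback/pushout diagrams. -/
structure YonedaExt (k : Type) [Field k] (C : Type u) [Category.{v} C] [Abelian C]
    [Linear k C] where
  ext : C → C → ModuleCat.{v} k
  pull : ∀ {X' X : C} (_ : X' ⟶ X) (Y : C), ext X Y →ₗ[k] ext X' Y
  push : ∀ (X : C) {Y Y' : C} (_ : Y ⟶ Y'), ext X Y →ₗ[k] ext X Y'
  pull_id : ∀ X Y : C, pull (𝟙 X) Y = LinearMap.id
  pull_comp : ∀ {X'' X' X : C} (f : X'' ⟶ X') (g : X' ⟶ X) (Y : C),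
    pull (f ≫ g) Y = (pull f Y).comp (pull g Y)
  pull_zero : ∀ (X' X Y : C), pull (0 : X' ⟶ X) Y = 0
  pull_add : ∀ {X' X : C} (f g : X' ⟶ X) (Y : C), pull (f + g) Y = pull f Y + pull g Y
  pull_smul : ∀ {X' X : C} (a : k) (f : X' ⟶ X) (Y : C), pull (a • f) Y = a • pull f Y
  push_id : ∀ X Y : C, push X (𝟙 Y) = LinearMap.id
  push_comp : ∀ (X : C) {Y Y' Y'' : C} (g : Y ⟶ Y') (g' : Y' ⟶ Y''),
    push X (g ≫ g') = (push X g').comp (push X g)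
  push_zero : ∀ (X Y Y' : C), push X (0 : Y ⟶ Y') = 0
  push_add : ∀ (X : C) {Y Y' : C} (g h : Y ⟶ Y'), push X (g + h) = push X g + push X h
  push_smul : ∀ (X : C) {Y Y' : C} (a : k) (g : Y ⟶ Y'), push X (a • g) = a • push X g
  pull_push : ∀ {X' X Y Y' : C} (f : X' ⟶ X) (g : Y ⟶ Y'),
    (push X' g).comp (pull f Y) = (pull f Y').comp (push X g)
  cls : ∀ {S : ShortComplex C}, S.ShortExact → ext S.X₃ S.X₁
  cls_eq_zero_iff : ∀ {S : ShortComplex C} (hS : S.ShortExact),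
    cls hS = 0 ↔ Nonempty S.Splitting
  cls_surjective : ∀ (X Y : C) (e : ext X Y), ∃ (E : C) (i : Y ⟶ E) (p : E ⟶ X)
    (w : i ≫ p = 0) (hS : (ShortComplex.mk i p w).ShortExact), cls hS = e
  cls_pull : ∀ {S : ShortComplex C} (hS : S.ShortExact) {Z : C} (f : Z ⟶ S.X₃),
    ∃ (E' : C) (i' : S.X₁ ⟶ E') (p' : E' ⟶ Z) (w' : i' ≫ p' = 0)
      (hS' : (ShortComplex.mk i' p' w').ShortExact) (m : E' ⟶ S.X₂),
      cls hS' = pull f S.X₁ (cls hS) ∧ i' ≫ m = S.f ∧ m ≫ S.g = p' ≫ f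
  cls_push : ∀ {S : ShortComplex C} (hS : S.ShortExact) {Z : C} (g : S.X₁ ⟶ Z),
    ∃ (E' : C) (i' : Z ⟶ E') (p' : E' ⟶ S.X₃) (w' : i' ≫ p' = 0)
      (hS' : (ShortComplex.mk i' p' w').ShortExact) (m : S.X₂ ⟶ E'),
      cls hS' = push S.X₃ g (cls hS) ∧ S.f ≫ m = g ≫ i' ∧ m ≫ p' = S.g

variable {k : Type} [Field k] {C : Type u} [Category.{v} C] [Abelian C] [Linear k C]

/-- The ideal of injectively trivial morphisms `M ⟶ X`, i.e. those `f` with `Ext(Z,f) = 0`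
for every `Z`. -/
def ITriv (T : YonedaExt k C) (M X : C) : Submodule k (M ⟶ X) where
  carrier := {f | ∀ Z : C, T.push Z f = 0}
  add_mem' := by
    intro f g hf hg Z
    rw [T.push_add, hf Z, hg Z, add_zero]
  zero_mem' := fun Z => T.push_zero Z _ _
  smul_mem' := by
    intro a f hf Z
    rw [T.push_smul, hf Z, smul_zero]

lemma mem_ITriv {T : YonedaExt k C} {M X : C} {f : M ⟶ X} :
    f ∈ ITriv T M X ↔ ∀ Z : C, T.push Z f = 0 := Iff.rfl

/-- The ideal of projectively trivial morphisms `M ⟶ X`, i.e. those `f` with `Ext(f,Z) = 0`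
for every `Z`. -/
def PTriv (T : YonedaExt k C) (M X : C) : Submodule k (M ⟶ X) where
  carrier := {f | ∀ Z : C, T.pull f Z = 0}
  add_mem' := by
    intro f g hf hg Z
    rw [T.pull_add, hf Z, hg Z, add_zero]
  zero_mem' := fun Z => T.pull_zero _ _ Z
  smul_mem' := by
    intro a f hf Z
    rw [T.pull_smul, hf Z, smul_zero]

lemma mem_PTriv {T : YonedaExt k C} {M X : C} {f : M ⟶ X} :
    f ∈ PTriv T M X ↔ ∀ Z : C, T.pull f Z = 0 := Iff.rfl

/-- Hom-spaces of the injectively stable category `C̄ = C/I`. -/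
abbrev HomBar (T : YonedaExt k C) (M X : C) := (M ⟶ X) ⧸ ITriv T M X

/-- Hom-spaces of the projectively stable category `C̲ = C/P`. -/
abbrev HomUnder (T : YonedaExt k C) (M X : C) := (M ⟶ X) ⧸ PTriv T M X

/-- `u : X ⟶ E` is left almost split: it is not a section, and every non-section
`X ⟶ Z` factors through it. -/
def IsLeftAlmostSplit {X E : C} (u : X ⟶ E) : Prop :=
  (¬ ∃ r : E ⟶ X, u ≫ r = 𝟙 X) ∧
  ∀ (Z : C) (f : X ⟶ Z), (¬ ∃ r : Z ⟶ X, f ≫ r = 𝟙 X) → ∃ h : E ⟶ Z, u ≫ h = f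

/-- `v : E ⟶ Y` is right almost split: it is not a retraction, and every non-retraction
`Z ⟶ Y` factors through it. -/
def IsRightAlmostSplit {E Y : C} (v : E ⟶ Y) : Prop :=
  (¬ ∃ s : Y ⟶ E, s ≫ v = 𝟙 Y) ∧
  ∀ (Z : C) (f : Z ⟶ Y), (¬ ∃ s : Y ⟶ Z, s ≫ f = 𝟙 Y) → ∃ h : Z ⟶ E, h ≫ v = f

/-- `X → E → Y` is an almost split conflation. -/
def IsAlmostSplitConflation {X E Y : C} (u : X ⟶ E) (v : E ⟶ Y) (w : u ≫ v = 0) : Prop :=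
  (ShortComplex.mk u v w).ShortExact ∧ IsLeftAlmostSplit u ∧ IsRightAlmostSplit v

/-- `Z` is a direct summand of `Y`. -/
def IsDirectSummand (Z Y : C) : Prop := ∃ (i : Z ⟶ Y) (r : Y ⟶ Z), i ≫ r = 𝟙 Z

/-- An indecomposable object. -/
def Indec (Y : C) : Prop :=
  ¬ IsZero Y ∧ ∀ A B : C, Nonempty (Y ≅ A ⊞ B) → IsZero A ∨ IsZero B

/-- Injective object of the exact category: every conflation starting at it splits,
equivalently `Ext(-,X)` vanishes. -/
def IsInjObj (T : YonedaExt k C) (X : C) : Prop := ∀ (Z : C) (e : T.ext Z X), e = 0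

/-- Projective object of the exact category: every conflation ending at it splits,
equivalently `Ext(X,-)` vanishes. -/
def IsProjObj (T : YonedaExt k C) (X : C) : Prop := ∀ (Z : C) (e : T.ext X Z), e = 0

/-- `Yt` represents the functor `D Ext(Y,-) : C̄ → k-Mod`, i.e. there is an isomorphism of
functors `Hom̄(-,Yt) ≅ D Ext(Y,-)`. -/
def RepresentsR (T : YonedaExt k C) (Y Yt : C) : Prop :=
  ∃ e : ∀ M : C, HomBar T M Yt ≃ₗ[k] Module.Dual k (T.ext Y M),
    ∀ (M M' : C) (h : M ⟶ M') (f : M' ⟶ Yt) (μ : T.ext Y M),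
      e M (Submodule.Quotient.mk (h ≫ f)) μ = e M' (Submodule.Quotient.mk f) (T.push Y h μ)

/-- `Xt` represents the functor `D Ext(-,X) : C̲ → k-Mod`, i.e. there is an isomorphism of
functors `Hom̲(Xt,-) ≅ D Ext(-,X)`. -/
def RepresentsL (T : YonedaExt k C) (X Xt : C) : Prop :=
  ∃ e : ∀ M : C, HomUnder T Xt M ≃ₗ[k] Module.Dual k (T.ext M X),
    ∀ (M M' : C) (h : M ⟶ M') (g : Xt ⟶ M) (μ : T.ext M' X),
      e M' (Submodule.Quotient.mk (g ≫ h)) μ = e M (Submodule.Quotient.mk g) (T.pull h X μ)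

/-- The full subcategory `C_r`: the functor `D Ext(X,-) : C̄ → k-Mod` is representable. -/
def MemCr (T : YonedaExt k C) (X : C) : Prop := ∃ Xt : C, RepresentsR T X Xt

/-- The full subcategory `C_l`: the functor `D Ext(-,X) : C̲ → k-Mod` is representable. -/
def MemCl (T : YonedaExt k C) (X : C) : Prop := ∃ Xt : C, RepresentsL T X Xt

/-- `X ≅ Y` in the projectively stable category `C̲`. -/
def StablyIsoP (T : YonedaExt k C) (X Y : C) : Prop :=
  ∃ (f : X ⟶ Y) (g : Y ⟶ X), f ≫ g - 𝟙 X ∈ PTriv T X X ∧ g ≫ f - 𝟙 Y ∈ PTriv T Y Y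

/-- `X ≅ Y` in the injectively stable category `C̄`. -/
def StablyIsoI (T : YonedaExt k C) (X Y : C) : Prop :=
  ∃ (f : X ⟶ Y) (g : Y ⟶ X), f ≫ g - 𝟙 X ∈ ITriv T X X ∧ g ≫ f - 𝟙 Y ∈ ITriv T Y Y

end GenAR
namespace GenAR

variable {k : Type} [Field k] {C : Type u} [Category.{v} C] [Abelian C] [Linear k C]

/-- If the endomorphism ring of `X` is local, then for every endomorphism `f` of `X` one of
`f` and `𝟙 X - f` is an isomorphism. -/
lemma isIso_or_isIso_id_sub {X : C} (hX : IsLocalRing (End X)) (f : X ⟶ X) :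
    IsIso f ∨ IsIso (𝟙 X - f) :=
  (IsLocalRing.isUnit_or_isUnit_of_add_one (R := End X) (add_sub_cancel f (𝟙 X))).imp
    (isUnit_iff_isIso f).1 (isUnit_iff_isIso (𝟙 X - f : End X)).1

/-- The morphisms out of a strongly indecomposable object `X` that are not sections form a
subspace of `X ⟶ A`. -/
def nonSections (k : Type) [Field k] [Linear k C] {X : C} (hX : IsLocalRing (End X)) (A : C) :
    Submodule k (X ⟶ A) where
  carrier := {f | ¬ ∃ r : A ⟶ X, f ≫ r = 𝟙 X}
  add_mem' := by
    rintro f g hf hg ⟨r, hr⟩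
    rcases isIso_or_isIso_id_sub hX (f ≫ r) with h | h
    · exact hf ⟨r ≫ inv (f ≫ r), by rw [← Category.assoc, IsIso.hom_inv_id]⟩
    · have e : 𝟙 X - f ≫ r = g ≫ r := by rw [← hr, Preadditive.add_comp, add_sub_cancel_left]
      rw [e] at h
      exact hg ⟨r ≫ inv (g ≫ r), by rw [← Category.assoc, IsIso.hom_inv_id]⟩
  zero_mem' := by
    rintro ⟨r, hr⟩
    rw [zero_comp] at hr
    exact zero_ne_one (α := End X) hr
  smul_mem' := by
    rintro a f hf ⟨r, hr⟩
    exact hf ⟨a • r, by rw [Linear.comp_smul, ← Linear.smul_comp, hr]⟩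

lemma mem_nonSections {X A : C} {hX : IsLocalRing (End X)} {f : X ⟶ A} :
    f ∈ nonSections k hX A ↔ ¬ ∃ r : A ⟶ X, f ≫ r = 𝟙 X := Iff.rfl

/-- If the class of a conflation is killed by pushout along `g`, then `g` factors through the
inflation. -/
lemma exists_factor_of_push_eq_zero (T : YonedaExt k C) {S : ShortComplex C}
    (hS : S.ShortExact) {Z : C} (g : S.X₁ ⟶ Z) (h : T.push S.X₃ g (T.cls hS) = 0) :
    ∃ t : S.X₂ ⟶ Z, S.f ≫ t = g := by
  obtain ⟨E', i', p', w', hS', m, hc, hm, -⟩ := T.cls_push hS g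
  obtain ⟨σ⟩ := (T.cls_eq_zero_iff hS').1 (hc.trans h)
  have hr : i' ≫ σ.r = 𝟙 Z := σ.f_r
  exact ⟨m ≫ σ.r, by rw [← Category.assoc, hm, Category.assoc, hr, Category.comp_id]⟩

/-- In a conflation whose inflation is left almost split and whose cokernel is strongly
indecomposable, the deflation is right almost split: a pullback of the conflation that does not
split yields an endomorphism of the conflation that is the identity on `X`. -/
lemma isRightAlmostSplit_of_isLeftAlmostSplit (T : YonedaExt k C) {X E Y : C}
    (hY : IsLocalRing (End Y)) {u : X ⟶ E} {v : E ⟶ Y} {w : u ≫ v = 0}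
    (hS : (ShortComplex.mk u v w).ShortExact) (hu : IsLeftAlmostSplit u) :
    IsRightAlmostSplit v := by
  have hepi : Epi v := hS.epi_g
  have hv : ¬ ∃ s : Y ⟶ E, s ≫ v = 𝟙 Y := by
    rintro ⟨s, hs⟩
    let σ := ShortComplex.Splitting.ofExactOfSection _ hS.exact s hs hS.mono_f
    exact hu.1 ⟨σ.r, σ.f_r⟩
  refine ⟨hv, fun Z f hf => ?_⟩
  obtain ⟨E', i', p', w', hS', m, -, hm, hmv⟩ := T.cls_pull hS f
  dsimp only at i' p' w' m hm hmv
  by_cases hi : ∃ r : E' ⟶ X, i' ≫ r = 𝟙 X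
  · obtain ⟨r, hr⟩ := hi
    let σ := ShortComplex.Splitting.ofExactOfRetraction _ hS'.exact r hr hS'.epi_g
    have hs : σ.s ≫ p' = 𝟙 Z := σ.s_g
    exact ⟨σ.s ≫ m, by rw [Category.assoc, hmv, ← Category.assoc, hs, Category.id_comp]⟩
  · exfalso
    obtain ⟨h, hh⟩ := hu.2 _ i' hi
    obtain ⟨s, hs⟩ : ∃ s : Y ⟶ Z, v ≫ s = h ≫ p' :=
      ⟨hS.exact.desc (h ≫ p') (by
        change u ≫ h ≫ p' = 0
        rw [← Category.assoc, hh, w']), hS.exact.g_desc _ _⟩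
    obtain ⟨c, hc⟩ : ∃ c : Y ⟶ E, v ≫ c = 𝟙 E - h ≫ m :=
      ⟨hS.exact.desc (𝟙 E - h ≫ m) (by
        change u ≫ (𝟙 E - h ≫ m) = 0
        rw [Preadditive.comp_sub, ← Category.assoc, hh, hm, Category.comp_id, sub_self]),
        hS.exact.g_desc _ _⟩
    have key : 𝟙 Y - s ≫ f = c ≫ v := by
      rw [← cancel_epi v, Preadditive.comp_sub, ← Category.assoc, hs, ← Category.assoc, hc,
        Preadditive.sub_comp, Category.assoc, Category.assoc, hmv, Category.comp_id,
        Category.id_comp]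
    rcases isIso_or_isIso_id_sub hY (s ≫ f) with hiso | hiso
    · exact hf ⟨inv (s ≫ f) ≫ s, by rw [Category.assoc, IsIso.inv_hom_id]⟩
    · rw [key] at hiso
      exact hv ⟨inv (c ≫ v) ≫ c, by rw [Category.assoc, IsIso.inv_hom_id]⟩

/-- A section out of a non-injective strongly indecomposable object is not, modulo injectively
trivial morphisms, equal to a non-section. -/
lemma mk_notMem_map_nonSections (T : YonedaExt k C) {X A : C} (hX : IsLocalRing (End X))
    (hinj : ¬ IsInjObj T X) {i : X ⟶ A} {r : A ⟶ X} (hir : i ≫ r = 𝟙 X) :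
    (Submodule.Quotient.mk i : HomBar T X A) ∉
      (nonSections k hX A).map (ITriv T X A).mkQ := by
  rintro ⟨g, hg, hgi⟩
  have htriv : i - g ∈ ITriv T X A := (Submodule.Quotient.eq _).1 hgi.symm
  have e : (i - g) ≫ r = 𝟙 X - g ≫ r := by rw [Preadditive.sub_comp, hir]
  rcases isIso_or_isIso_id_sub hX (g ≫ r) with h | h
  · exact hg ⟨r ≫ inv (g ≫ r), by rw [← Category.assoc, IsIso.hom_inv_id]⟩
  · rw [← e] at h
    refine hinj fun Z μ => ?_
    have h0 : T.push Z (𝟙 X) = 0 := by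
      rw [← IsIso.hom_inv_id ((i - g) ≫ r), Category.assoc, T.push_comp,
        mem_ITriv.1 htriv Z, LinearMap.comp_zero]
    have h1 := LinearMap.congr_fun h0 μ
    rwa [T.push_id] at h1

/-- If `D Ext(Y,-)` is represented by an object with a non-injective strongly indecomposable
summand `X`, then there is a nonzero class in `Ext(Y,X)` killed by pushout along every
morphism that is not a section. -/
lemma exists_almost_vanishing_class (T : YonedaExt k C) {X Y Y' : C}
    [FiniteDimensional k (X ⟶ Y')] (hrep : RepresentsR T Y Y') (hX : IsLocalRing (End X))
    (hinj : ¬ IsInjObj T X) (hsum : IsDirectSummand X Y') :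
    ∃ μ : T.ext Y X, μ ≠ 0 ∧
      ∀ (Z : C) (g : X ⟶ Z), (¬ ∃ r : Z ⟶ X, g ≫ r = 𝟙 X) → T.push Y g μ = 0 := by
  obtain ⟨i, r, hir⟩ := hsum
  obtain ⟨e, he⟩ := hrep
  let N := (nonSections k hX Y').map (ITriv T X Y').mkQ
  let W : Submodule k (Module.Dual k (T.ext Y X)) := N.map (e X).toLinearMap
  have hW : e X (Submodule.Quotient.mk i) ∉ W.dualCoannihilator.dualAnnihilator := by
    rw [Subspace.dualCoannihilator_dualAnnihilator_eq]
    rintro ⟨x, hx, hxe⟩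
    rw [(e X).injective hxe] at hx
    exact mk_notMem_map_nonSections T hX hinj hir hx
  rw [Submodule.mem_dualAnnihilator] at hW
  push Not at hW
  obtain ⟨μ, hμ, hμi⟩ := hW
  refine ⟨μ, fun h0 => hμi (by rw [h0, map_zero]), fun Z g hg => ?_⟩
  rw [← Module.forall_dual_apply_eq_zero_iff k]
  intro φ
  obtain ⟨q, rfl⟩ := (e Z).surjective φ
  obtain ⟨f, rfl⟩ := Submodule.Quotient.mk_surjective _ q
  rw [← he X Z g f μ]
  refine (Submodule.mem_dualCoannihilator μ).1 hμ _
    (Submodule.mem_map_of_mem (Submodule.mem_map_of_mem (mem_nonSections.2 ?_)))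
  rintro ⟨t, ht⟩
  exact hg ⟨f ≫ t, by rw [← Category.assoc, ht]⟩

/-- **Lemma 2.2(1)**.  Let `Y` be strongly indecomposable with
`D Ext(Y,-) ≅ Hom̄(-,Y')` for some `Y'`.  If `Y'` has a non-injective strongly
indecomposable direct summand, then there exists an almost split conflation ending at `Y`. -/
theorem lemma_ass_1
    (homFinite : ∀ X Y : C, FiniteDimensional k (X ⟶ Y))
    (T : YonedaExt k C)
    (Y : C) (hY : IsLocalRing (End Y))
    (Y' : C) (hrep : RepresentsR T Y Y')
    (hsummand : ∃ X : C, IsDirectSummand X Y' ∧ IsLocalRing (End X) ∧ ¬ IsInjObj T X) :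
    ∃ (X E : C) (u : X ⟶ E) (v : E ⟶ Y) (w : u ≫ v = 0),
      IsAlmostSplitConflation u v w := by
  obtain ⟨X, hsum, hX, hinj⟩ := hsummand
  have := homFinite X Y'
  obtain ⟨μ, hμ, hpush⟩ := exists_almost_vanishing_class T hrep hX hinj hsum
  obtain ⟨E, u, v, w, hS, rfl⟩ := T.cls_surjective Y X μ
  have hu : IsLeftAlmostSplit u := by
    refine ⟨?_, fun Z g hg => exists_factor_of_push_eq_zero T hS g (hpush Z g hg)⟩
    rintro ⟨t, ht⟩
    exact hμ ((T.cls_eq_zero_iff hS).2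
      ⟨ShortComplex.Splitting.ofExactOfRetraction _ hS.exact t ht hS.epi_g⟩)
  exact ⟨X, E, u, v, w, hS, hu, isRightAlmostSplit_of_isLeftAlmostSplit T hY hS hu⟩

end GenAR
end

section
/- Let Y be a strongly indecomposable object of C. Assume that there is an isomorphism of functors D Ext(−,Y) ≅ Hom̲(Y',−) on C for some object Y', and that Y' has a non-projective strongly indecomposable direct summand. Then there exists an almost split conflation Y → E → Z in C starting at Y. -/
/-!
Common setup: a Hom-finite Krull-Schmidt `k`-linear abelian category `C`, regarded as an exact
category whose conflations are all short exact sequences.  The Yoneda Ext¹-bifunctor of this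
exact structure, together with the assignment of its extension class to each short exact
sequence and the standard pullback/pushout functorialities, is axiomatized by the structure
`YonedaExt` below.  (Over a field, Hom-finiteness together with the existence of an abelian
structure makes `C` Krull-Schmidt automatically.)
-/

open CategoryTheory CategoryTheory.Limits

universe v u

namespace GenAR

variable {k : Type} [Field k] {C : Type u} [Category.{v} C] [Abelian C] [Linear k C]

/-- In a local endomorphism ring, a sum of two endomorphisms equal to the identity has an
invertible summand. -/
lemma isIso_or_isIso_of_add_eq_id {X : C} [IsLocalRing (End X)] {a b : X ⟶ X}
    (h : a + b = 𝟙 X) : IsIso a ∨ IsIso b := by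
  have h' : (show End X from a) + (show End X from b) = 1 := h
  exact (IsLocalRing.isUnit_or_isUnit_of_add_one h').imp
    (isUnit_iff_isIso a).1 (isUnit_iff_isIso b).1

/-- The deflation of a conflation with vanishing class is a retraction. -/
lemma exists_section_of_cls_eq_zero (T : YonedaExt k C) {S : ShortComplex C}
    (hS : S.ShortExact) (h : T.cls hS = 0) : ∃ s : S.X₃ ⟶ S.X₂, s ≫ S.g = 𝟙 S.X₃ := by
  obtain ⟨σ⟩ := (T.cls_eq_zero_iff hS).1 h
  exact ⟨σ.s, σ.s_g⟩

/-- The inflation of a conflation with vanishing class is a section. -/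
lemma exists_retraction_of_cls_eq_zero (T : YonedaExt k C) {S : ShortComplex C}
    (hS : S.ShortExact) (h : T.cls hS = 0) : ∃ r : S.X₂ ⟶ S.X₁, S.f ≫ r = 𝟙 S.X₁ := by
  obtain ⟨σ⟩ := (T.cls_eq_zero_iff hS).1 h
  exact ⟨σ.r, σ.f_r⟩

/-- A conflation whose deflation is a retraction has vanishing class. -/
lemma cls_eq_zero_of_section (T : YonedaExt k C) {S : ShortComplex C}
    (hS : S.ShortExact) (s : S.X₃ ⟶ S.X₂) (h : s ≫ S.g = 𝟙 S.X₃) : T.cls hS = 0 :=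
  (T.cls_eq_zero_iff hS).2 ⟨ShortComplex.Splitting.ofExactOfSection S hS.exact s h hS.mono_f⟩

/-- A conflation whose inflation is a section has vanishing class. -/
lemma cls_eq_zero_of_retraction (T : YonedaExt k C) {S : ShortComplex C}
    (hS : S.ShortExact) (r : S.X₂ ⟶ S.X₁) (h : S.f ≫ r = 𝟙 S.X₁) : T.cls hS = 0 :=
  (T.cls_eq_zero_iff hS).2 ⟨ShortComplex.Splitting.ofExactOfRetraction S hS.exact r h hS.epi_g⟩

/-- The deflation of a conflation is right almost split as soon as its class is nonzero and is
killed by pullback along every non-retraction. -/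
lemma isRightAlmostSplit_of_pull_eq_zero (T : YonedaExt k C) {S : ShortComplex C}
    (hS : S.ShortExact) (hne : T.cls hS ≠ 0)
    (hpull : ∀ (Z : C) (f : Z ⟶ S.X₃), (¬ ∃ s : S.X₃ ⟶ Z, s ≫ f = 𝟙 S.X₃) →
      T.pull f S.X₁ (T.cls hS) = 0) :
    IsRightAlmostSplit S.g := by
  refine ⟨fun ⟨s, hs⟩ => hne (cls_eq_zero_of_section T hS s hs), fun Z f hf => ?_⟩
  obtain ⟨E', i', p', w', hS', m, hcls, -, hm⟩ := T.cls_pull hS f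
  obtain ⟨s, hs⟩ := exists_section_of_cls_eq_zero T hS' (hcls.trans (hpull Z f hf))
  have hs' : s ≫ p' = 𝟙 Z := hs
  exact ⟨s ≫ m, by rw [Category.assoc, hm, reassoc_of% hs']⟩

/-- If the deflation of a conflation is right almost split and its starting term has local
endomorphism ring, then its inflation is left almost split. -/
lemma isLeftAlmostSplit_of_isRightAlmostSplit (T : YonedaExt k C) {S : ShortComplex C}
    (hS : S.ShortExact) [IsLocalRing (End S.X₁)] (hg : IsRightAlmostSplit S.g) :
    IsLeftAlmostSplit S.f := by
  have := hS.mono_f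
  have hf : ¬ ∃ r : S.X₂ ⟶ S.X₁, S.f ≫ r = 𝟙 S.X₁ := fun ⟨r, hr⟩ =>
    hg.1 (exists_section_of_cls_eq_zero T hS (cls_eq_zero_of_retraction T hS r hr))
  refine ⟨hf, fun Z f hfZ => ?_⟩
  obtain ⟨E', i', p', w', hS', m, -, hm, hmp⟩ := T.cls_push hS f
  by_cases hsec : ∃ s : S.X₃ ⟶ E', s ≫ p' = 𝟙 S.X₃
  · obtain ⟨s, hs⟩ := hsec
    obtain ⟨r, hr⟩ := exists_retraction_of_cls_eq_zero T hS' (cls_eq_zero_of_section T hS' s hs)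
    have hr' : i' ≫ r = 𝟙 Z := hr
    exact ⟨m ≫ r, by rw [reassoc_of% hm, hr', Category.comp_id]⟩
  · exfalso
    obtain ⟨h, hh⟩ := hg.2 E' p' hsec
    obtain ⟨t, ht⟩ : ∃ t : Z ⟶ S.X₁, t ≫ S.f = i' ≫ h :=
      ⟨hS.exact.lift (i' ≫ h) (by rw [Category.assoc, hh, w']), hS.exact.lift_f _ _⟩
    obtain ⟨q, hq⟩ : ∃ q : S.X₂ ⟶ S.X₁, q ≫ S.f = 𝟙 _ - m ≫ h :=
      ⟨hS.exact.lift (𝟙 _ - m ≫ h) (by simp [hh, hmp]), hS.exact.lift_f _ _⟩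
    have hsum : f ≫ t + S.f ≫ q = 𝟙 S.X₁ := by
      rw [← cancel_mono S.f]
      simp only [Preadditive.add_comp, Category.assoc, ht, hq, Preadditive.comp_sub,
        Category.comp_id, Category.id_comp, reassoc_of% hm]
      abel
    rcases isIso_or_isIso_of_add_eq_id hsum with hi | hi
    · exact hfZ ⟨t ≫ inv (f ≫ t), by rw [← Category.assoc, IsIso.hom_inv_id]⟩
    · exact hf ⟨q ≫ inv (S.f ≫ q), by rw [← Category.assoc, IsIso.hom_inv_id]⟩

/-- The non-retractions `A ⟶ X` form a subspace when `X` has local endomorphism ring. -/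
def nonRetractions (k : Type) [Field k] {C : Type u} [Category.{v} C] [Abelian C] [Linear k C]
    (A X : C) [IsLocalRing (End X)] : Submodule k (A ⟶ X) where
  carrier := {f | ¬ ∃ s : X ⟶ A, s ≫ f = 𝟙 X}
  add_mem' := by
    rintro f g hf hg ⟨s, hs⟩
    rw [Preadditive.comp_add] at hs
    rcases isIso_or_isIso_of_add_eq_id hs with hi | hi
    · exact hf ⟨inv (s ≫ f) ≫ s, by rw [Category.assoc, IsIso.inv_hom_id]⟩
    · exact hg ⟨inv (s ≫ g) ≫ s, by rw [Category.assoc, IsIso.inv_hom_id]⟩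
  zero_mem' := by
    rintro ⟨s, hs⟩
    rw [comp_zero] at hs
    exact zero_ne_one (α := End X) hs
  smul_mem' := by
    rintro a f hf ⟨s, hs⟩
    exact hf ⟨a • s, by rw [Linear.smul_comp, ← Linear.comp_smul, hs]⟩

lemma mem_nonRetractions {A X : C} [IsLocalRing (End X)] {f : A ⟶ X} :
    f ∈ nonRetractions k A X ↔ ¬ ∃ s : X ⟶ A, s ≫ f = 𝟙 X := Iff.rfl

/-- A projectively trivial morphism to a non-projective object is not a retraction. -/
lemma PTriv_le_nonRetractions (T : YonedaExt k C) (A X : C) [IsLocalRing (End X)]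
    (hX : ¬ IsProjObj T X) : PTriv T A X ≤ nonRetractions k A X := by
  rintro f hf ⟨s, hs⟩
  refine hX fun Z e => ?_
  have h : T.pull (𝟙 X) Z e = 0 := by
    rw [← hs, T.pull_comp, mem_PTriv.1 hf Z, LinearMap.comp_zero, LinearMap.zero_apply]
  rwa [T.pull_id] at h

/-- If `D Ext(-,Y)` is represented by `A` with `Hom(A,X)` finite-dimensional, and `X` is a
non-projective strongly indecomposable summand of `A`, then `Ext(X,Y)` has a nonzero element
killed by pullback along every non-retraction to `X`. -/
lemma exists_ne_zero_pull_eq_zero (T : YonedaExt k C) {Y A X : C} [FiniteDimensional k (A ⟶ X)]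
    [IsLocalRing (End X)] (hrep : RepresentsL T Y A) (hXA : IsDirectSummand X A)
    (hX : ¬ IsProjObj T X) :
    ∃ μ : T.ext X Y, μ ≠ 0 ∧ ∀ (Z : C) (f : Z ⟶ X), (¬ ∃ s : X ⟶ Z, s ≫ f = 𝟙 X) →
      T.pull f Y μ = 0 := by
  obtain ⟨e, he⟩ := hrep
  obtain ⟨i, r, hir⟩ := hXA
  have : FiniteDimensional k (Module.Dual k (T.ext X Y)) := (e X).finiteDimensional
  set W : Submodule k (Module.Dual k (T.ext X Y)) :=
    (nonRetractions k A X).map ((e X).toLinearMap ∘ₗ (PTriv T A X).mkQ)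
  have hr : e X (Submodule.Quotient.mk r) ∉ W := by
    rintro ⟨f, hf, hfr⟩
    have hfr' : (Submodule.Quotient.mk f : HomUnder T A X) = Submodule.Quotient.mk r :=
      (e X).injective hfr
    have hmem := PTriv_le_nonRetractions T A X hX ((Submodule.Quotient.eq _).1 hfr')
    have : r ∈ nonRetractions k A X := by
      simpa using (nonRetractions k A X).sub_mem hf hmem
    exact this ⟨i, hir⟩
  have hne : W.dualCoannihilator ≠ ⊥ := by
    intro h
    apply hr
    rw [← Subspace.dualCoannihilator_dualAnnihilator_eq (W := W), h]
    simp
  obtain ⟨μ, hμ, hμ0⟩ := Submodule.exists_mem_ne_zero_of_ne_bot hne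
  refine ⟨μ, hμ0, fun Z f hf => ?_⟩
  rw [← Module.forall_dual_apply_eq_zero_iff k]
  intro φ
  obtain ⟨x, rfl⟩ := (e Z).surjective φ
  obtain ⟨g, rfl⟩ := Submodule.Quotient.mk_surjective _ x
  rw [← he]
  refine (Submodule.mem_dualCoannihilator _).1 hμ _ ⟨g ≫ f, ?_, rfl⟩
  rintro ⟨s, hs⟩
  exact hf ⟨s ≫ g, by rw [Category.assoc, hs]⟩

/-- **Lemma 2.2(2)**.  Let `Y` be strongly indecomposable with
`D Ext(-,Y) ≅ Hom̲(Y',-)` for some `Y'`.  If `Y'` has a non-projective strongly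
indecomposable direct summand, then there exists an almost split conflation starting
at `Y`. -/
theorem lemma_ass_2
    (homFinite : ∀ X Y : C, FiniteDimensional k (X ⟶ Y))
    (T : YonedaExt k C)
    (Y : C) (hY : IsLocalRing (End Y))
    (Y' : C) (hrep : RepresentsL T Y Y')
    (hsummand : ∃ X : C, IsDirectSummand X Y' ∧ IsLocalRing (End X) ∧ ¬ IsProjObj T X) :
    ∃ (E Z : C) (u : Y ⟶ E) (v : E ⟶ Z) (w : u ≫ v = 0),
      IsAlmostSplitConflation u v w := by
  obtain ⟨X, hXY', hXloc, hX⟩ := hsummand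
  have := homFinite Y' X
  obtain ⟨μ, hμ0, hμ⟩ := exists_ne_zero_pull_eq_zero T hrep hXY' hX
  obtain ⟨E, u, v, w, hS, rfl⟩ := T.cls_surjective X Y μ
  have hv := isRightAlmostSplit_of_pull_eq_zero T hS hμ0 hμ
  exact ⟨E, X, u, v, w, hS, isLeftAlmostSplit_of_isRightAlmostSplit T hS hv, hv⟩

end GenAR
end

section
/- Let Y be an indecomposable non-projective object of C. Then Y lies in C_r if and only if there exists an almost split conflation X → E → Y in C ending at Y. -/
/-!
Common setup: a Hom-finite Krull-Schmidt `k`-linear abelian category `C`, regarded as an exact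
category whose conflations are all short exact sequences.  The Yoneda Ext¹-bifunctor of this
exact structure, together with the assignment of its extension class to each short exact
sequence and the standard pullback/pushout functorialities, is axiomatized by the structure
`YonedaExt` below.  (Over a field, Hom-finiteness together with the existence of an abelian
structure makes `C` Krull-Schmidt automatically.)
-/

open CategoryTheory CategoryTheory.Limits

universe v u

namespace GenAR

variable {k : Type} [Field k] {C : Type u} [Category.{v} C] [Abelian C] [Linear k C]

lemma isUnit_or_isNilpotent_of_idempotents_trivial {K R : Type*} [Field K] [Ring R] [Algebra K R]
    [FiniteDimensional K R] (h : ∀ p : R, IsIdempotentElem p → p = 0 ∨ p = 1) (e : R) :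
    IsUnit e ∨ IsNilpotent e := by
  obtain ⟨n, x, hcomm, hx⟩ : ∃ (n : ℕ) (x : R), Commute e x ∧ e ^ n = x * e ^ (n + 1) := by
    have hp : minpoly K e ≠ 0 := minpoly.ne_zero (Algebra.IsIntegral.isIntegral e)
    obtain ⟨q, hq, hXq⟩ :=
      (FiniteMultiplicity.of_not_isUnit Polynomial.not_isUnit_X hp).exists_eq_pow_mul_and_not_dvd
    obtain ⟨a, b, hab⟩ := Polynomial.irreducible_X.coprime_iff_not_dvd.mpr hXq
    generalize multiplicity Polynomial.X (minpoly K e) = n at hq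
    refine ⟨n, Polynomial.aeval e a, ?_, ?_⟩
    · have := (Commute.all Polynomial.X a).map (Polynomial.aeval e)
      rwa [Polynomial.aeval_X] at this
    · have key : (Polynomial.X : Polynomial K) ^ n
          = a * Polynomial.X ^ (n + 1) + b * minpoly K e := by
        rw [hq]
        linear_combination (-Polynomial.X ^ n) * hab
      simpa using congrArg (Polynomial.aeval e) key
  have hpow : ∀ m : ℕ, e ^ n = x ^ m * e ^ (n + m) := by
    intro m
    induction m with
    | zero => simp
    | succ m ih =>
      calc e ^ n = x ^ m * (e ^ n * e ^ m) := by rw [← pow_add, ← ih]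
        _ = x ^ m * (x * e ^ (n + 1) * e ^ m) := by rw [← hx]
        _ = x ^ (m + 1) * e ^ (n + (m + 1)) := by
          rw [pow_succ x m, mul_assoc x, ← pow_add, ← mul_assoc, add_right_comm, add_assoc n]
  have hn : e ^ n = x ^ n * e ^ n * e ^ n := by
    rw [mul_assoc, ← pow_add]
    exact hpow n
  have hc : Commute (e ^ n) (x ^ n) := hcomm.pow_pow n n
  have hid : IsIdempotentElem (x ^ n * e ^ n) := by
    change x ^ n * e ^ n * (x ^ n * e ^ n) = x ^ n * e ^ n
    rw [← mul_assoc, mul_assoc (x ^ n) (e ^ n) (x ^ n), hc.eq, mul_assoc, ← hn]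
  rcases h _ hid with h0 | h1
  · right
    refine ⟨n, ?_⟩
    rw [hn, h0, zero_mul]
  · left
    have hxe : x * e = 1 := by
      have h2 : e ^ n * x ^ n = 1 := by rw [hc.eq, h1]
      calc x * e = x * e * (e ^ n * x ^ n) := by rw [h2, mul_one]
        _ = x * e ^ (n + 1) * x ^ n := by rw [pow_succ' e n]; simp only [mul_assoc]
        _ = 1 := by rw [← hx, h2]
    exact ⟨⟨e, x, by rw [hcomm.eq, hxe], hxe⟩, rfl⟩

lemma Indec.eq_zero_or_eq_id_of_idem {Y : C} (hY : Indec Y) (p : Y ⟶ Y) (hp : p ≫ p = p) :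
    p = 0 ∨ p = 𝟙 Y := by
  have split : ∀ q : Y ⟶ Y, q ≫ q = q →
      ∃ (A : C) (π : Y ⟶ A) (ι : A ⟶ Y), π ≫ ι = q ∧ ι ≫ π = 𝟙 A := by
    intro q hq
    refine ⟨image q, factorThruImage q, image.ι q, image.fac q, ?_⟩
    rw [← cancel_mono (image.ι q), ← cancel_epi (factorThruImage q)]
    simp [hq]
  obtain ⟨A, π, ι, hA, hA'⟩ := split p hp
  obtain ⟨B, ρ, κ, hB, hB'⟩ := split (𝟙 Y - p) (by simp [hp])
  have h1 : ι ≫ ρ = 0 := by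
    have : π ≫ (ι ≫ ρ) ≫ κ = 0 := by
      rw [Category.assoc, hB, ← Category.assoc, hA]; simp [hp]
    calc ι ≫ ρ = (ι ≫ π) ≫ (ι ≫ ρ) ≫ (κ ≫ ρ) := by simp [hA', hB']
      _ = ι ≫ (π ≫ (ι ≫ ρ) ≫ κ) ≫ ρ := by simp only [Category.assoc]
      _ = 0 := by rw [this, zero_comp, comp_zero]
  have h2 : κ ≫ π = 0 := by
    have : ρ ≫ (κ ≫ π) ≫ ι = 0 := by
      rw [Category.assoc, hA, ← Category.assoc, hB]; simp [hp]
    calc κ ≫ π = (κ ≫ ρ) ≫ (κ ≫ π) ≫ (ι ≫ π) := by simp [hA', hB']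
      _ = κ ≫ (ρ ≫ (κ ≫ π) ≫ ι) ≫ π := by simp only [Category.assoc]
      _ = 0 := by rw [this, zero_comp, comp_zero]
  let i : Y ≅ A ⊞ B :=
    { hom := biprod.lift π ρ
      inv := biprod.desc ι κ
      hom_inv_id := by simp [hA, hB]
      inv_hom_id := by
        apply biprod.hom_ext' <;> apply biprod.hom_ext <;> simp [hA', hB', h1, h2] }
  rcases hY.2 A B ⟨i⟩ with h | h
  · left
    rw [← hA, h.eq_of_tgt π 0, zero_comp]
  · right
    rw [h.eq_of_tgt ρ 0, zero_comp] at hB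
    exact (sub_eq_zero.mp hB.symm).symm

lemma Indec.isUnit_or_isNilpotent {Y : C} (hY : Indec Y) [FiniteDimensional k (Y ⟶ Y)]
    (e : End Y) : IsUnit e ∨ IsNilpotent e :=
  have : FiniteDimensional k (End Y) := ‹FiniteDimensional k (Y ⟶ Y)›
  isUnit_or_isNilpotent_of_idempotents_trivial (K := k) hY.eq_zero_or_eq_id_of_idem e

lemma finrank_end_image_lt {X : C} [FiniteDimensional k (X ⟶ X)] {e : X ⟶ X}
    (he : ¬ ∃ r : X ⟶ X, e ≫ r = 𝟙 X) :
    Module.finrank k (image e ⟶ image e) < Module.finrank k (X ⟶ X) := by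
  let L : (image e ⟶ image e) →ₗ[k] (X ⟶ X) :=
    (Linear.leftComp k X (factorThruImage e)).comp (Linear.rightComp k (image e) (image.ι e))
  have hL : ∀ a, L a = factorThruImage e ≫ a ≫ image.ι e := fun a => rfl
  have hinj : Function.Injective L := by
    intro a b hab
    rwa [hL, hL, cancel_epi, cancel_mono] at hab
  rw [← LinearMap.finrank_range_of_inj hinj]
  refine Submodule.finrank_lt fun htop => he ?_
  obtain ⟨a, ha⟩ := LinearMap.range_eq_top.mp htop (𝟙 X)
  rw [hL] at ha
  have hι : image.ι e ≫ factorThruImage e ≫ a = 𝟙 _ := by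
    rw [← cancel_mono (image.ι e)]
    simp [ha]
  refine ⟨factorThruImage e ≫ a ≫ a ≫ image.ι e, ?_⟩
  calc e ≫ factorThruImage e ≫ a ≫ a ≫ image.ι e
      = factorThruImage e ≫ (image.ι e ≫ factorThruImage e ≫ a) ≫ a ≫ image.ι e := by simp
    _ = 𝟙 X := by rw [hι, Category.id_comp, ha]

namespace YonedaExt

variable {T : YonedaExt k C}

lemma pull_comp_apply (T : YonedaExt k C) {X'' X' X : C} (f : X'' ⟶ X') (g : X' ⟶ X) {Y : C}
    (ξ : T.ext X Y) : T.pull (f ≫ g) Y ξ = T.pull f Y (T.pull g Y ξ) := by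
  rw [T.pull_comp, LinearMap.comp_apply]

lemma push_comp_apply (T : YonedaExt k C) {X Y Y' Y'' : C} (f : Y ⟶ Y') (g : Y' ⟶ Y'')
    (ξ : T.ext X Y) : T.push X (f ≫ g) ξ = T.push X g (T.push X f ξ) := by
  rw [T.push_comp, LinearMap.comp_apply]

lemma pull_id_apply (T : YonedaExt k C) {X Y : C} (ξ : T.ext X Y) : T.pull (𝟙 X) Y ξ = ξ := by
  rw [T.pull_id, LinearMap.id_apply]

lemma push_id_apply (T : YonedaExt k C) {X Y : C} (ξ : T.ext X Y) : T.push X (𝟙 Y) ξ = ξ := by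
  rw [T.push_id, LinearMap.id_apply]

lemma push_pull_apply (T : YonedaExt k C) {X' X Y Y' : C} (f : X' ⟶ X) (g : Y ⟶ Y')
    (ξ : T.ext X Y) : T.push X' g (T.pull f Y ξ) = T.pull f Y' (T.push X g ξ) :=
  LinearMap.congr_fun (T.pull_push f g) ξ

lemma pull_sub_apply (T : YonedaExt k C) {X' X Y : C} (f g : X' ⟶ X) (ξ : T.ext X Y) :
    T.pull (f - g) Y ξ = T.pull f Y ξ - T.pull g Y ξ := by
  rw [eq_sub_iff_add_eq, ← LinearMap.add_apply, ← T.pull_add, sub_add_cancel]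

lemma push_sub_apply (T : YonedaExt k C) {X Y Y' : C} (f g : Y ⟶ Y') (ξ : T.ext X Y) :
    T.push X (f - g) ξ = T.push X f ξ - T.push X g ξ := by
  rw [eq_sub_iff_add_eq, ← LinearMap.add_apply, ← T.push_add, sub_add_cancel]

lemma pull_ne_zero_of_retraction {X Y Z : C} {ξ : T.ext Y X} (hξ : ξ ≠ 0) {f : Z ⟶ Y}
    (hf : ∃ s : Y ⟶ Z, s ≫ f = 𝟙 Y) : T.pull f X ξ ≠ 0 := by
  obtain ⟨s, hs⟩ := hf
  intro h
  apply hξ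
  rw [← T.pull_id_apply ξ, ← hs, T.pull_comp_apply, h, map_zero]

lemma push_ne_zero_of_section {X Y Z : C} {ξ : T.ext Y X} (hξ : ξ ≠ 0) {f : X ⟶ Z}
    (hf : ∃ r : Z ⟶ X, f ≫ r = 𝟙 X) : T.push Y f ξ ≠ 0 := by
  obtain ⟨r, hr⟩ := hf
  intro h
  apply hξ
  rw [← T.push_id_apply ξ, ← hr, T.push_comp_apply, h, map_zero]

/-- `X → E → Y` is a conflation whose extension class is `ξ`. -/
def Realizes (T : YonedaExt k C) {X E Y : C} (u : X ⟶ E) (v : E ⟶ Y) (ξ : T.ext Y X) : Prop :=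
  ∃ (w : u ≫ v = 0) (hS : (ShortComplex.mk u v w).ShortExact), T.cls hS = ξ

lemma exists_realizes {X Y : C} (ξ : T.ext Y X) :
    ∃ (E : C) (u : X ⟶ E) (v : E ⟶ Y), T.Realizes u v ξ := by
  obtain ⟨E, u, v, w, hS, h⟩ := T.cls_surjective Y X ξ
  exact ⟨E, u, v, w, hS, h⟩

namespace Realizes

variable {X E Y : C} {u : X ⟶ E} {v : E ⟶ Y} {ξ : T.ext Y X}

lemma comp_eq_zero (h : T.Realizes u v ξ) : u ≫ v = 0 := h.1

lemma mono (h : T.Realizes u v ξ) : Mono u := by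
  obtain ⟨w, hS, _⟩ := h
  exact hS.mono_f

lemma epi (h : T.Realizes u v ξ) : Epi v := by
  obtain ⟨w, hS, _⟩ := h
  exact hS.epi_g

lemma exists_lift (h : T.Realizes u v ξ) {Z : C} (f : Z ⟶ E) (hf : f ≫ v = 0) :
    ∃ l : Z ⟶ X, l ≫ u = f := by
  obtain ⟨w, hS, _⟩ := h
  have := hS.mono_f
  exact ⟨hS.exact.lift f hf, hS.exact.lift_f f hf⟩

lemma exists_desc (h : T.Realizes u v ξ) {Z : C} (f : E ⟶ Z) (hf : u ≫ f = 0) :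
    ∃ l : Y ⟶ Z, v ≫ l = f := by
  obtain ⟨w, hS, _⟩ := h
  have := hS.epi_g
  exact ⟨hS.exact.desc f hf, hS.exact.g_desc f hf⟩

lemma exists_pull (h : T.Realizes u v ξ) {Z : C} (f : Z ⟶ Y) :
    ∃ (E' : C) (u' : X ⟶ E') (v' : E' ⟶ Z) (m : E' ⟶ E),
      T.Realizes u' v' (T.pull f X ξ) ∧ u' ≫ m = u ∧ m ≫ v = v' ≫ f := by
  obtain ⟨w, hS, rfl⟩ := h
  obtain ⟨E', u', v', w', hS', m, h1, h2, h3⟩ := T.cls_pull hS f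
  exact ⟨E', u', v', m, ⟨w', hS', h1⟩, h2, h3⟩

lemma exists_push (h : T.Realizes u v ξ) {Z : C} (g : X ⟶ Z) :
    ∃ (E' : C) (u' : Z ⟶ E') (v' : E' ⟶ Y) (m : E ⟶ E'),
      T.Realizes u' v' (T.push Y g ξ) ∧ u ≫ m = g ≫ u' ∧ m ≫ v' = v := by
  obtain ⟨w, hS, rfl⟩ := h
  obtain ⟨E', u', v', w', hS', m, h1, h2, h3⟩ := T.cls_push hS g
  exact ⟨E', u', v', m, ⟨w', hS', h1⟩, h2, h3⟩

lemma eq_zero_iff_exists_section (h : T.Realizes u v ξ) :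
    ξ = 0 ↔ ∃ s : Y ⟶ E, s ≫ v = 𝟙 Y := by
  obtain ⟨w, hS, rfl⟩ := h
  refine (T.cls_eq_zero_iff hS).trans ⟨fun ⟨σ⟩ => ⟨σ.s, σ.s_g⟩, fun ⟨s, hs⟩ => ?_⟩
  exact ⟨.ofExactOfSection _ hS.exact s hs hS.mono_f⟩

lemma eq_zero_iff_exists_retraction (h : T.Realizes u v ξ) :
    ξ = 0 ↔ ∃ r : E ⟶ X, u ≫ r = 𝟙 X := by
  obtain ⟨w, hS, rfl⟩ := h
  refine (T.cls_eq_zero_iff hS).trans ⟨fun ⟨σ⟩ => ⟨σ.r, σ.f_r⟩, fun ⟨r, hr⟩ => ?_⟩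
  exact ⟨.ofExactOfRetraction _ hS.exact r hr hS.epi_g⟩

lemma pull_eq_zero_iff (h : T.Realizes u v ξ) {Z : C} (f : Z ⟶ Y) :
    T.pull f X ξ = 0 ↔ ∃ l : Z ⟶ E, l ≫ v = f := by
  obtain ⟨E', u', v', m, h', hm, hm'⟩ := h.exists_pull f
  constructor
  · intro h0
    obtain ⟨s, hs⟩ := h'.eq_zero_iff_exists_section.mp h0
    exact ⟨s ≫ m, by rw [Category.assoc, hm', ← Category.assoc, hs, Category.id_comp]⟩
  · rintro ⟨l, hl⟩
    obtain ⟨r, hr⟩ := h.exists_lift (m - v' ≫ l) (by simp [hm', hl])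
    have := h.mono
    refine h'.eq_zero_iff_exists_retraction.mpr ⟨r, ?_⟩
    rw [← cancel_mono u, Category.assoc, hr, Preadditive.comp_sub, hm, ← Category.assoc,
      h'.comp_eq_zero]
    simp

lemma push_eq_zero_iff (h : T.Realizes u v ξ) {Z : C} (f : X ⟶ Z) :
    T.push Y f ξ = 0 ↔ ∃ l : E ⟶ Z, u ≫ l = f := by
  obtain ⟨E', u', v', m, h', hm, hm'⟩ := h.exists_push f
  constructor
  · intro h0
    obtain ⟨r, hr⟩ := h'.eq_zero_iff_exists_retraction.mp h0
    exact ⟨m ≫ r, by rw [← Category.assoc, hm, Category.assoc, hr, Category.comp_id]⟩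
  · rintro ⟨l, hl⟩
    obtain ⟨s, hs⟩ := h.exists_desc (m - l ≫ u') (by simp [hm, reassoc_of% hl])
    have := h.epi
    refine h'.eq_zero_iff_exists_section.mpr ⟨s, ?_⟩
    rw [← cancel_epi v, ← Category.assoc, hs, Preadditive.sub_comp, hm', Category.assoc,
      h'.comp_eq_zero]
    simp

end Realizes

/-- Exactness of `Hom(Y,Z) → Ext(Y,X) → Ext(Y,E)` for a conflation `X → E → Z` of class `ν`,
in terms of annihilators. -/
lemma exists_pull_eq {X Y Z : C} (ν : T.ext Z X) (κ : T.ext Y X)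
    (h : ∀ (W : C) (u : X ⟶ W), T.push Z u ν = 0 → T.push Y u κ = 0) :
    ∃ g : Y ⟶ Z, T.pull g X ν = κ := by
  let ξ : T.ext (Z ⊞ Y) X := T.pull biprod.fst X ν + T.pull biprod.snd X κ
  have hν : T.pull biprod.inl X ξ = ν := by
    simp only [ξ, map_add, ← T.pull_comp_apply, biprod.inl_fst, biprod.inl_snd, T.pull_id_apply,
      T.pull_zero, LinearMap.zero_apply, add_zero]
  have hκ : T.pull biprod.inr X ξ = κ := by
    simp only [ξ, map_add, ← T.pull_comp_apply, biprod.inr_fst, biprod.inr_snd, T.pull_id_apply,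
      T.pull_zero, LinearMap.zero_apply, zero_add]
  obtain ⟨E, i, p, hE⟩ := exists_realizes ξ
  obtain ⟨E₁, u₁, p₁, m₁, h₁, hu₁, hp₁⟩ := hE.exists_pull biprod.inl
  obtain ⟨E₂, u₂, p₂, m₂, h₂, hu₂, hp₂⟩ := hE.exists_pull biprod.inr
  rw [hν] at h₁
  rw [hκ] at h₂
  obtain ⟨t, ht⟩ := (h₂.push_eq_zero_iff u₁).mp
    (h _ u₁ ((h₁.push_eq_zero_iff u₁).mpr ⟨𝟙 _, Category.comp_id _⟩))
  obtain ⟨g, hg⟩ := h₂.exists_desc (t ≫ p₁) (by rw [← Category.assoc, ht, h₁.comp_eq_zero])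
  obtain ⟨s, hs⟩ := h₂.exists_desc (t ≫ m₁ - m₂)
    (by rw [Preadditive.comp_sub, ← Category.assoc, ht, hu₁, hu₂, sub_self])
  have := h₂.epi
  have hsp : s ≫ p = g ≫ biprod.inl - biprod.inr := by
    rw [← cancel_epi p₂, ← Category.assoc, hs, Preadditive.sub_comp, Category.assoc, hp₁, hp₂,
      Preadditive.comp_sub, ← Category.assoc, ← hg, Category.assoc]
  have h0 := (hE.pull_eq_zero_iff _).mpr ⟨s, hsp⟩
  rw [T.pull_sub_apply, T.pull_comp_apply, hν, hκ] at h0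
  exact ⟨g, sub_eq_zero.mp h0⟩

/-- Exactness of `Hom(M,X) → Ext(Y,X) → Ext(E,X)` for a conflation `M → E → Y` of class `ν`,
in terms of annihilators. -/
lemma exists_push_eq {X M Y : C} (ν : T.ext Y M) (κ : T.ext Y X)
    (h : ∀ (W : C) (v : W ⟶ Y), T.pull v M ν = 0 → T.pull v X κ = 0) :
    ∃ g : M ⟶ X, T.push Y g ν = κ := by
  let ξ : T.ext Y (M ⊞ X) := T.push Y biprod.inl ν + T.push Y biprod.inr κ
  have hν : T.push Y biprod.fst ξ = ν := by
    simp only [ξ, map_add, ← T.push_comp_apply, biprod.inl_fst, biprod.inr_fst, T.push_id_apply,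
      T.push_zero, LinearMap.zero_apply, add_zero]
  have hκ : T.push Y biprod.snd ξ = κ := by
    simp only [ξ, map_add, ← T.push_comp_apply, biprod.inl_snd, biprod.inr_snd, T.push_id_apply,
      T.push_zero, LinearMap.zero_apply, zero_add]
  obtain ⟨E, i, p, hE⟩ := exists_realizes ξ
  obtain ⟨E₁, i₁, p₁, m₁, h₁, hi₁, hp₁⟩ := hE.exists_push biprod.fst
  obtain ⟨E₂, i₂, p₂, m₂, h₂, hi₂, hp₂⟩ := hE.exists_push biprod.snd
  rw [hν] at h₁
  rw [hκ] at h₂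
  obtain ⟨t, ht⟩ := (h₂.pull_eq_zero_iff p₁).mp
    (h _ p₁ ((h₁.pull_eq_zero_iff p₁).mpr ⟨𝟙 _, Category.id_comp _⟩))
  obtain ⟨g, hg⟩ := h₂.exists_lift (i₁ ≫ t) (by rw [Category.assoc, ht, h₁.comp_eq_zero])
  obtain ⟨s, hs⟩ := h₂.exists_lift (m₁ ≫ t - m₂)
    (by rw [Preadditive.sub_comp, Category.assoc, ht, hp₁, hp₂, sub_self])
  have := h₂.mono
  have hsp : i ≫ s = biprod.fst ≫ g - biprod.snd := by
    rw [← cancel_mono i₂, Category.assoc, hs, Preadditive.comp_sub, ← Category.assoc, hi₁, hi₂,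
      Preadditive.sub_comp, Category.assoc, ← hg, Category.assoc]
  have h0 := (hE.push_eq_zero_iff _).mpr ⟨s, hsp⟩
  rw [T.push_sub_apply, T.push_comp_apply, hν, hκ] at h0
  exact ⟨g, sub_eq_zero.mp h0⟩

/-- A nonzero class killed by pullback along every non-retraction. -/
def IsRightSocle {X Y : C} (μ : T.ext Y X) : Prop :=
  μ ≠ 0 ∧ ∀ (Z : C) (f : Z ⟶ Y), (¬ ∃ s : Y ⟶ Z, s ≫ f = 𝟙 Y) → T.pull f X μ = 0

/-- A nonzero class killed by pushout along every non-section. -/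
def IsLeftSocle {X Y : C} (μ : T.ext Y X) : Prop :=
  μ ≠ 0 ∧ ∀ (Z : C) (f : X ⟶ Z), (¬ ∃ r : Z ⟶ X, f ≫ r = 𝟙 X) → T.push Y f μ = 0

lemma Realizes.isRightAlmostSplit_iff {X E Y : C} {u : X ⟶ E} {v : E ⟶ Y} {μ : T.ext Y X}
    (h : T.Realizes u v μ) : IsRightAlmostSplit v ↔ IsRightSocle μ := by
  simp only [IsRightAlmostSplit, IsRightSocle, h.pull_eq_zero_iff, Ne,
    h.eq_zero_iff_exists_section]

lemma Realizes.isLeftAlmostSplit_iff {X E Y : C} {u : X ⟶ E} {v : E ⟶ Y} {μ : T.ext Y X}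
    (h : T.Realizes u v μ) : IsLeftAlmostSplit u ↔ IsLeftSocle μ := by
  simp only [IsLeftAlmostSplit, IsLeftSocle, h.push_eq_zero_iff, Ne,
    h.eq_zero_iff_exists_retraction]

lemma IsLeftSocle.exists_pull_eq {X Y Z : C} {μ : T.ext Y X} (hμ : IsLeftSocle μ)
    {ν : T.ext Z X} (hν : ν ≠ 0) : ∃ g : Y ⟶ Z, T.pull g X ν = μ :=
  YonedaExt.exists_pull_eq ν μ fun W u hu =>
    hμ.2 W u fun hr => push_ne_zero_of_section hν hr hu

lemma IsRightSocle.exists_push_eq {X Y M : C} {μ : T.ext Y X} (hμ : IsRightSocle μ)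
    {ν : T.ext Y M} (hν : ν ≠ 0) : ∃ g : M ⟶ X, T.push Y g ν = μ :=
  YonedaExt.exists_push_eq ν μ fun W v hv =>
    hμ.2 W v fun hr => pull_ne_zero_of_retraction hν hr hv

lemma IsRightSocle.push {X Y Z : C} {μ : T.ext Y X} (hμ : IsRightSocle μ) {f : X ⟶ Z}
    (hf : T.push Y f μ ≠ 0) : IsRightSocle (T.push Y f μ) :=
  ⟨hf, fun W g hg => by rw [← T.push_pull_apply, hμ.2 W g hg, map_zero]⟩

/-- The pairing `Hom(M,X) × Ext(Y,M) → k` induced by a linear form on `Ext(Y,X)`. -/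
def pairing (T : YonedaExt k C) {X Y : C} (φ : Module.Dual k (T.ext Y X)) (M : C) :
    (M ⟶ X) →ₗ[k] Module.Dual k (T.ext Y M) where
  toFun f := φ.comp (T.push Y f)
  map_add' f g := by rw [T.push_add, LinearMap.comp_add]
  map_smul' a f := by rw [T.push_smul, LinearMap.comp_smul, RingHom.id_apply]

lemma representsR_of_isSocle (homFinite : ∀ X Y : C, FiniteDimensional k (X ⟶ Y)) {X Y : C}
    {μ : T.ext Y X} (hl : IsLeftSocle μ) (hr : IsRightSocle μ) : RepresentsR T Y X := by
  obtain ⟨φ, hφ⟩ : ∃ φ : Module.Dual k (T.ext Y X), φ μ ≠ 0 := by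
    by_contra! h
    exact hl.1 ((Module.forall_dual_apply_eq_zero_iff k μ).mp h)
  have hker : ∀ M, (T.pairing φ M).ker = ITriv T M X := by
    intro M
    ext f
    rw [LinearMap.mem_ker, mem_ITriv]
    constructor
    · intro hf Z
      by_contra hne
      obtain ⟨e, he⟩ := DFunLike.ne_iff.mp hne
      obtain ⟨g, hg⟩ := hl.exists_pull_eq he
      apply hφ
      rw [← hg, ← T.push_pull_apply]
      exact LinearMap.congr_fun hf _
    · intro hf
      change φ.comp (T.push Y f) = 0
      rw [hf Y, LinearMap.comp_zero]
  let B : ∀ M, HomBar T M X →ₗ[k] Module.Dual k (T.ext Y M) := fun M =>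
    (ITriv T M X).liftQ (T.pairing φ M) (hker M).ge
  have hB : ∀ M, Function.Bijective (B M) := by
    intro M
    have hinj : Function.Injective (B M) := by
      rw [← LinearMap.ker_eq_bot]
      exact Submodule.ker_liftQ_eq_bot _ _ _ (hker M).le
    have hinj' : Function.Injective (B M).flip := by
      rw [injective_iff_map_eq_zero]
      intro ν hν
      by_contra hne
      obtain ⟨g, hg⟩ := hr.exists_push_eq hne
      apply hφ
      rw [← hg]
      exact LinearMap.congr_fun hν (Submodule.Quotient.mk g)
    have := homFinite M X
    exact (LinearMap.IsPerfPair.of_injective hinj hinj').bijective_left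
  refine ⟨fun M => LinearEquiv.ofBijective (B M) (hB M), fun M M' h f ν => ?_⟩
  change φ (T.push Y (h ≫ f) ν) = φ (T.push Y f (T.push Y h ν))
  rw [T.push_comp_apply]

/-- If `X` represents `D Ext(Y,-)`, then some linear form on `Ext(Y,X)` detects nonzero classes
in `Ext(Z,X)` after pullback along morphisms `Y ⟶ Z`. -/
lemma exists_dual_detecting {X Y : C} (h : RepresentsR T Y X) :
    ∃ θ : Module.Dual k (T.ext Y X), ∀ (Z : C) (ν : T.ext Z X), ν ≠ 0 →
      ∃ g : Y ⟶ Z, θ (T.pull g X ν) ≠ 0 := by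
  obtain ⟨e, he⟩ := h
  refine ⟨e X (Submodule.Quotient.mk (𝟙 X)), fun Z ν hν => ?_⟩
  have hθ : ∀ (M : C) (f : M ⟶ X) (κ : T.ext Y M),
      e M (Submodule.Quotient.mk f) κ = e X (Submodule.Quotient.mk (𝟙 X)) (T.push Y f κ) := by
    intro M f κ
    rw [← he, Category.comp_id]
  generalize e X (Submodule.Quotient.mk (𝟙 X)) = θ at hθ
  by_contra! hg
  obtain ⟨E, u, v, hE⟩ := exists_realizes ν
  have hu : T.push Z u ν = 0 := (hE.push_eq_zero_iff u).mpr ⟨𝟙 _, Category.comp_id _⟩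
  have hker : (T.push Y u).ker ≤ θ.ker := by
    intro κ hκ
    obtain ⟨g, rfl⟩ := exists_pull_eq ν κ fun W f hf => by
      obtain ⟨l, rfl⟩ := (hE.push_eq_zero_iff f).mp hf
      rw [T.push_comp_apply, LinearMap.mem_ker.mp hκ, map_zero]
    exact hg g
  obtain ⟨ψ, hψ⟩ : θ ∈ (T.push Y u).dualMap.range := by
    rw [LinearMap.range_dualMap_eq_dualAnnihilator_ker, Submodule.mem_dualAnnihilator]
    exact fun κ hκ => hker hκ
  obtain ⟨r, hr⟩ := (e E).surjective ψ
  obtain ⟨r, rfl⟩ := Submodule.Quotient.mk_surjective _ r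
  have heq : (Submodule.Quotient.mk (u ≫ r) : HomBar T X X) = Submodule.Quotient.mk (𝟙 X) := by
    apply (e X).injective
    ext κ
    rw [he, hr, hθ X (𝟙 X), T.push_id_apply, ← hψ]
    rfl
  have hI := (Submodule.Quotient.eq _).mp heq
  have h0 := LinearMap.congr_fun (hI Z) ν
  rw [T.push_sub_apply, T.push_comp_apply, hu, map_zero, T.push_id_apply] at h0
  apply hν
  simpa using h0

/-- The submodule `ξ · End(Y)` of `Ext(Y,X)`. -/
def pullSpan (T : YonedaExt k C) {X Y : C} (ξ : T.ext Y X) : Submodule k (T.ext Y X) :=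
  LinearMap.range (M := Y ⟶ Y)
    { toFun := fun r => T.pull r X ξ
      map_add' := fun r s => by rw [T.pull_add, LinearMap.add_apply]
      map_smul' := fun a r => by rw [T.pull_smul, LinearMap.smul_apply, RingHom.id_apply] }

lemma mem_pullSpan {X Y : C} {ξ ζ : T.ext Y X} :
    ζ ∈ T.pullSpan ξ ↔ ∃ r : Y ⟶ Y, T.pull r X ξ = ζ := Iff.rfl

lemma eq_zero_of_pull_eq_self {X Y : C} [FiniteDimensional k (Y ⟶ Y)] (hY : Indec Y)
    {e : End Y} (he : ¬ ∃ s : Y ⟶ Y, s ≫ e = 𝟙 Y) {μ : T.ext Y X} (hμ : T.pull e X μ = μ) :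
    μ = 0 := by
  rcases hY.isUnit_or_isNilpotent (k := k) e with h | ⟨n, hn⟩
  · obtain ⟨s, hs⟩ := h.exists_right_inv
    exact absurd ⟨s, hs⟩ he
  · have hpow : ∀ m : ℕ, T.pull (e ^ m : End Y) X μ = μ := by
      intro m
      induction m with
      | zero => exact T.pull_id_apply μ
      | succ m ih =>
        rw [pow_succ]
        change T.pull (e ≫ (e ^ m : End Y)) X μ = μ
        rw [T.pull_comp_apply, ih, hμ]
    have h := hpow n
    rw [hn] at h
    exact h.symm.trans (LinearMap.congr_fun (T.pull_zero Y Y X) μ)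

lemma exists_killed_by_nonretractions {X Y : C} [FiniteDimensional k (Y ⟶ Y)] (hY : Indec Y)
    {ξ : T.ext Y X} (hξ : ξ ≠ 0) :
    ∃ μ : T.ext Y X, μ ≠ 0 ∧
      ∀ r : Y ⟶ Y, (¬ ∃ s : Y ⟶ Y, s ≫ r = 𝟙 Y) → T.pull r X μ = 0 := by
  induction hn : Module.finrank k (T.pullSpan ξ) using Nat.strong_induction_on generalizing ξ with
  | _ n ih =>
    by_cases h : ∀ r : Y ⟶ Y, (¬ ∃ s : Y ⟶ Y, s ≫ r = 𝟙 Y) → T.pull r X ξ = 0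
    · exact ⟨ξ, hξ, h⟩
    · push Not at h
      obtain ⟨r, hr, hne⟩ := h
      have hle : T.pullSpan (T.pull r X ξ) ≤ T.pullSpan ξ := by
        rintro _ ⟨s, rfl⟩
        exact ⟨s ≫ r, T.pull_comp_apply s r ξ⟩
      have hfin : FiniteDimensional k (T.pullSpan ξ) := by
        unfold pullSpan
        infer_instance
      refine ih _ ?_ hne rfl
      rw [← hn]
      refine Submodule.finrank_lt_finrank_of_lt (lt_of_le_of_ne hle fun heq => ?_)
      obtain ⟨s, hs⟩ := mem_pullSpan.mp (heq.ge (mem_pullSpan.mpr ⟨𝟙 Y, T.pull_id_apply ξ⟩))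
      rw [← T.pull_comp_apply] at hs
      exact hξ (eq_zero_of_pull_eq_self hY
        (fun ⟨t, ht⟩ => hr (t ≫ s) (by rw [Category.assoc, ht])) hs)

lemma exists_isRightSocle (homFinite : ∀ X Y : C, FiniteDimensional k (X ⟶ Y)) {X Y : C}
    (hY : Indec Y) (hnp : ¬ IsProjObj T Y) (h : RepresentsR T Y X) :
    ∃ μ : T.ext Y X, IsRightSocle μ := by
  have := homFinite Y Y
  obtain ⟨θ, hθ⟩ := exists_dual_detecting h
  obtain ⟨ξ, hξ⟩ : ∃ ξ : T.ext Y X, ξ ≠ 0 := by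
    obtain ⟨e, -⟩ := h
    simp only [IsProjObj, not_forall] at hnp
    obtain ⟨M, ν, hν⟩ := hnp
    by_contra! h0
    apply hν
    rw [← Module.forall_dual_apply_eq_zero_iff k]
    intro φ
    obtain ⟨f, rfl⟩ := (e M).surjective φ
    obtain ⟨f, rfl⟩ := Submodule.Quotient.mk_surjective _ f
    have hf : f ∈ ITriv T M X := by
      intro Z
      ext κ
      by_contra hκ
      obtain ⟨g, hg⟩ := hθ Z _ hκ
      exact hg (by rw [h0 (T.pull g X _), map_zero])
    rw [(Submodule.Quotient.mk_eq_zero _).mpr hf, map_zero, LinearMap.zero_apply]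
  obtain ⟨μ, hμ, hμ'⟩ := exists_killed_by_nonretractions hY hξ
  refine ⟨μ, hμ, fun Z f hf => ?_⟩
  by_contra hne
  obtain ⟨g, hg⟩ := hθ Z _ hne
  apply hg
  rw [← T.pull_comp_apply, hμ' (g ≫ f), map_zero]
  rintro ⟨s, hs⟩
  exact hf ⟨s ≫ g, by rw [Category.assoc, hs]⟩

lemma IsRightSocle.exists_isSocle (homFinite : ∀ X Y : C, FiniteDimensional k (X ⟶ Y))
    {X Y : C} {μ : T.ext Y X} (hμ : IsRightSocle μ) :
    ∃ (X' : C) (μ' : T.ext Y X'), IsLeftSocle μ' ∧ IsRightSocle μ' := by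
  induction hn : Module.finrank k (X ⟶ X) using Nat.strong_induction_on generalizing X with
  | _ n ih =>
    by_cases hl : IsLeftSocle μ
    · exact ⟨X, μ, hl, hμ⟩
    · simp only [IsLeftSocle, not_and, not_forall] at hl
      obtain ⟨Z, f, hf, hne⟩ := hl hμ.1
      obtain ⟨g, hg⟩ := hμ.exists_push_eq hne
      have hfg : ¬ ∃ r : X ⟶ X, (f ≫ g) ≫ r = 𝟙 X := by
        rintro ⟨r, hr⟩
        exact hf ⟨g ≫ r, by rw [← Category.assoc, hr]⟩
      have hpush : T.push Y (factorThruImage (f ≫ g)) μ ≠ 0 := by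
        intro h0
        apply hμ.1
        rw [← hg, ← T.push_comp_apply, ← image.fac (f ≫ g), T.push_comp_apply, h0, map_zero]
      have := homFinite X X
      exact ih _ (hn ▸ finrank_end_image_lt hfg) (hμ.push hpush) rfl

end YonedaExt

/-- **Proposition 2.4(1)**.  A non-projective indecomposable object `Y` lies in `C_r` if and
only if there exists an almost split conflation ending at `Y`. -/
theorem prop_Cr
    (homFinite : ∀ X Y : C, FiniteDimensional k (X ⟶ Y))
    (T : YonedaExt k C)
    (Y : C) (hind : Indec Y) (hnp : ¬ IsProjObj T Y) :
    MemCr T Y ↔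
      ∃ (X E : C) (u : X ⟶ E) (v : E ⟶ Y) (w : u ≫ v = 0),
        IsAlmostSplitConflation u v w := by
  constructor
  · rintro ⟨Yt, h⟩
    obtain ⟨μ₀, hμ₀⟩ := YonedaExt.exists_isRightSocle homFinite hind hnp h
    obtain ⟨X, μ, hl, hr⟩ := hμ₀.exists_isSocle homFinite
    obtain ⟨E, u, v, hE⟩ := YonedaExt.exists_realizes μ
    have ⟨w, hS, _⟩ := hE
    exact ⟨X, E, u, v, w, hS, hE.isLeftAlmostSplit_iff.mpr hl, hE.isRightAlmostSplit_iff.mpr hr⟩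
  · rintro ⟨X, E, u, v, w, hS, hl, hr⟩
    have hE : T.Realizes u v (T.cls hS) := ⟨w, hS, rfl⟩
    exact ⟨X, YonedaExt.representsR_of_isSocle homFinite (hE.isLeftAlmostSplit_iff.mp hl)
      (hE.isRightAlmostSplit_iff.mp hr)⟩

end GenAR
end
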